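/- Let Γ be a connected graph that is δ-hyperbolic (thin triangles) and fine. Then Γ is alternatively hyperbolic: for every edge e there exists a finite set F of edges such that every geodesic triangle containing e on one of its sides contains an edge of F on another side. Specifically, one may take F to be e together with all edges lying on circuits of length at most 24δ+6 through e. -/

import Mathlib

/-- A walk is a geodesic if its length realizes the graph distance between its endpoints. -/
def IsGeodesic {M : Type*} (Γ : SimpleGraph M) {a b : M} (p : Γ.Walk a b) : Prop :=
  p.length = Γ.dist a b

namespace SimpleGraph

variable {V : Type*} {G : SimpleGraph V}

theorem Walk.dist_add_dist_le_length {x y z : V} (w : G.Walk x y) (hz : z ∈ w.support) :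
    G.dist x z + G.dist z y ≤ w.length := by
  classical
  have h := congrArg Walk.length (w.take_spec hz)
  rw [Walk.length_append] at h
  have h₁ := dist_le (w.takeUntil z hz)
  have h₂ := dist_le (w.dropUntil z hz)
  omega

/-- The part of a walk between its `i`-th and its `j`-th vertex. -/
theorem Walk.exists_walk_getVert {x y : V} (w : G.Walk x y) {i j : ℕ} (hij : i ≤ j)
    (hj : j ≤ w.length) :
    ∃ v : G.Walk (w.getVert i) (w.getVert j), v.length = j - i ∧ v.edges ⊆ w.edges ∧
      ∀ z ∈ v.support, ∃ l, i ≤ l ∧ l ≤ j ∧ z = w.getVert l := by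
  have h : (w.drop i).getVert (j - i) = w.getVert j := by
    rw [Walk.drop_getVert]; congr 1; omega
  have hlen : (((w.drop i).take (j - i)).copy rfl h).length = j - i := by
    simp [Walk.take_length, Walk.drop_length]; omega
  refine ⟨((w.drop i).take (j - i)).copy rfl h, hlen, ?_, fun z hz ↦ ?_⟩
  · rw [Walk.edges_copy]
    exact ((Walk.isSubwalk_take _ _).trans (Walk.isSubwalk_drop _ _)).edges_subset
  · obtain ⟨l, rfl, hl⟩ := Walk.mem_support_iff_exists_getVert.mp hz
    rw [hlen] at hl
    refine ⟨i + l, by omega, by omega, ?_⟩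
    rw [Walk.getVert_copy, Walk.take_getVert, Walk.drop_getVert, min_eq_right hl]

/-- If a walk joins the ends of an edge `s(x, y)` outside `S` and crosses the boundary of a set
separating `x` from `y` only along `S`, then some circuit passes through `s(x, y)` and `S`. -/
theorem Walk.exists_isCycle_of_crossing_edges {x y : V}
    (h : G.Adj x y) (w : G.Walk x y) {A : Set V} {S : Set (Sym2 V)} (hx : x ∈ A) (hy : y ∉ A)
    (hS : s(x, y) ∉ S)
    (hw : ∀ s t, s(s, t) ∈ w.edges → s ∈ A → t ∉ A → s(s, t) ∈ S) :
    ∃ c : G.Walk y y, c.IsCycle ∧ c.length ≤ w.length + 1 ∧ s(x, y) ∈ c.edges ∧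
      ∃ f ∈ S, f ∈ c.edges := by
  classical
  obtain ⟨d, hd, hdA, hdB⟩ := w.bypass.exists_boundary_dart A hx hy
  have hde : s(d.fst, d.snd) ∈ w.bypass.edges := List.mem_map_of_mem hd
  refine ⟨.cons h.symm w.bypass, ?_, ?_, ?_, s(d.fst, d.snd), ?_, ?_⟩
  · rw [Walk.cons_isCycle_iff]
    refine ⟨w.bypass_isPath, fun he ↦ hS ?_⟩
    rw [Sym2.eq_swap] at he
    exact hw _ _ (w.edges_bypass_subset_edges he) hx hy
  · simpa using w.length_bypass_le_length
  · simp [Sym2.eq_swap]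
  · exact hw _ _ (w.edges_bypass_subset_edges hde) hdA hdB
  · simp [hde]

/-- Removing an edge from a circuit leaves a path joining the ends of that edge. -/
theorem Walk.IsCycle.exists_isPath_of_mem_edges
    {x y z : V} {c : G.Walk z z} (hc : c.IsCycle) (he : s(x, y) ∈ c.edges) :
    ∃ p : G.Walk y x, p.IsPath ∧ p.length ≤ c.length ∧
      ∀ f ∈ c.edges, f = s(x, y) ∨ f ∈ p.edges := by
  classical
  have hx : x ∈ c.support := c.fst_mem_support_of_mem_edges he
  have hc' := hc.rotate hx
  have hl : (c.rotate x hx).length = c.length := by simp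
  have hE : ∀ f, f ∈ c.edges ↔ f ∈ (c.rotate x hx).edges :=
    fun f ↦ (c.rotate_edges x hx).mem_iff.symm
  simp only [hE] at he ⊢
  rw [← hl]
  clear hE hl
  generalize c.rotate x hx = c' at *
  cases c' with
  | nil => simp at he
  | @cons _ v _ h p =>
    rw [Walk.cons_isCycle_iff] at hc'
    rw [Walk.edges_cons, List.mem_cons] at he
    rcases he with he | he
    · obtain rfl : y = v := by
        have := h.ne; grind
      exact ⟨p, hc'.1, by simp, by simp⟩
    · obtain ⟨q, rfl⟩ : ∃ q, p = Walk.reverse q := ⟨p.reverse, by simp⟩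
      rw [Walk.edges_reverse, List.mem_reverse] at he
      rw [Walk.isPath_reverse_iff] at hc'
      cases q with
      | nil => simp at he
      | @cons _ u _ h' q =>
        rw [Walk.cons_isPath_iff] at hc'
        have hq : s(x, y) ∉ q.edges := fun h'' ↦ hc'.1.2 (q.fst_mem_support_of_mem_edges h'')
        obtain rfl : y = u := by
          have := h'.ne; rw [Walk.edges_cons, List.mem_cons] at he; grind
        refine ⟨q.concat h.symm, hc'.1.1.concat hc'.1.2 h.symm, by simp, ?_⟩
        intro f hf
        simp only [Walk.edges_cons, Walk.edges_reverse, Walk.edges_concat, List.mem_cons,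
          List.mem_reverse, List.mem_append, List.concat_eq_append] at hf ⊢
        rw [Sym2.eq_swap (a := v)]
        tauto

theorem finite_edges_of_isCycle_of_length_le
    (hfine : ∀ (x y : V) (n : ℕ), {w : G.Walk x y | w.IsPath ∧ w.length ≤ n}.Finite)
    (e : Sym2 V) (n : ℕ) :
    {f : Sym2 V | ∃ (x : V) (w : G.Walk x x), w.IsCycle ∧ w.length ≤ n ∧
      e ∈ w.edges ∧ f ∈ w.edges}.Finite := by
  induction e with
  | _ x y =>
  refine (((hfine y x n).biUnion fun p _ ↦ p.edges.finite_toSet).insert s(x, y)).subset ?_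
  rintro f ⟨z, c, hc, hcn, he, hf⟩
  obtain ⟨p, hp, hpl, hpf⟩ := hc.exists_isPath_of_mem_edges he
  rcases hpf f hf with rfl | hfp
  · exact Set.mem_insert _ _
  · exact Set.mem_insert_of_mem _ (Set.mem_biUnion ⟨hp, hpl.trans hcn⟩ hfp)

end SimpleGraph

namespace IsGeodesic

open SimpleGraph

variable {V : Type*} {G : SimpleGraph V} {a b c : V}

theorem reverse {p : G.Walk a b} (hp : IsGeodesic G p) : IsGeodesic G p.reverse := by
  rw [IsGeodesic, Walk.length_reverse, hp, dist_comm]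

theorem dist_getVert (hG : G.Connected) {p : G.Walk a b} (hp : IsGeodesic G p) {l : ℕ}
    (hl : l ≤ p.length) :
    G.dist a (p.getVert l) = l ∧ G.dist (p.getVert l) b = p.length - l := by
  have h₁ := dist_le (p.take l)
  have h₂ := dist_le (p.drop l)
  have h₃ := hG.dist_triangle (u := a) (v := p.getVert l) (w := b)
  rw [Walk.take_length] at h₁
  rw [Walk.drop_length] at h₂
  rw [IsGeodesic] at hp
  omega

end IsGeodesic

namespace SimpleGraph

variable {V : Type*} {G : SimpleGraph V} {a b c : V}

/-- The points of the `δ`-neighbourhood of a geodesic of length `n` from `a` to `b` whose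
projection to the geodesic is at most `k`. -/
def leftNeighborhood (G : SimpleGraph V) (a b : V) (k δ : ℕ) : Set V :=
  {z | G.dist a z + G.dist a b ≤ 2 * k + G.dist z b ∧
    G.dist a z + G.dist z b ≤ G.dist a b + 2 * δ}

theorem exists_walk_subset_leftNeighborhood (hG : G.Connected) {p : G.Walk a b}
    (hp : IsGeodesic G p) {i k δ : ℕ} (hik : i ≤ k) (hk : k ≤ p.length) {u : V}
    (hu : G.dist (p.getVert i) u ≤ δ) (hiu : i + G.dist (p.getVert i) u ≤ k) :
    ∃ w : G.Walk (p.getVert k) u, w.length ≤ k - i + δ ∧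
      ∀ z ∈ w.support, z ∈ G.leftNeighborhood a b k δ := by
  obtain ⟨v, hv, -, hvs⟩ := p.exists_walk_getVert hik hk
  obtain ⟨t, ht⟩ := hG.exists_walk_length_eq_dist (p.getVert i) u
  have hab : p.length = G.dist a b := hp
  refine ⟨v.reverse.append t, by simp; omega, fun z hz ↦ ?_⟩
  rw [Walk.mem_support_append_iff, Walk.support_reverse, List.mem_reverse] at hz
  simp only [leftNeighborhood, Set.mem_ofPred_eq]
  rcases hz with hz | hz
  · obtain ⟨l, hil, hlk, rfl⟩ := hvs z hz
    have := hp.dist_getVert hG (hlk.trans hk)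
    omega
  · have h₁ := t.dist_add_dist_le_length hz
    have h₂ := hp.dist_getVert hG (hik.trans hk)
    have h₃ := hG.dist_triangle (u := a) (v := p.getVert i) (w := z)
    have h₄ := hG.dist_triangle (u := p.getVert i) (v := z) (w := b)
    have h₅ := hG.dist_triangle (u := z) (v := p.getVert i) (w := b)
    rw [G.dist_comm (u := z) (v := p.getVert i)] at h₅
    omega

theorem exists_walk_disjoint_leftNeighborhood (hG : G.Connected) {p : G.Walk a b}
    (hp : IsGeodesic G p) {k m δ : ℕ} (hkm : k + 1 ≤ m) (hm : m ≤ p.length) {v : V}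
    (hv : G.dist (p.getVert m) v ≤ δ) (hmv : k + 1 + G.dist (p.getVert m) v ≤ m) :
    ∃ w : G.Walk v (p.getVert (k + 1)), w.length ≤ m - (k + 1) + δ ∧
      ∀ z ∈ w.support, z ∉ G.leftNeighborhood a b k δ := by
  obtain ⟨w, hw, -, hws⟩ := p.exists_walk_getVert hkm hm
  obtain ⟨t, ht⟩ := hG.exists_walk_length_eq_dist (p.getVert m) v
  have hab : p.length = G.dist a b := hp
  refine ⟨t.reverse.append w.reverse, by simp; omega, fun z hz ↦ ?_⟩
  simp only [Walk.mem_support_append_iff, Walk.support_reverse, List.mem_reverse] at hz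
  simp only [leftNeighborhood, Set.mem_ofPred_eq]
  rcases hz with hz | hz
  · have h₁ := t.dist_add_dist_le_length hz
    have h₂ := hp.dist_getVert hG hm
    have h₃ := hG.dist_triangle (u := a) (v := z) (w := p.getVert m)
    have h₅ := hG.dist_triangle (u := z) (v := p.getVert m) (w := b)
    rw [G.dist_comm (u := z) (v := p.getVert m)] at h₃ h₅
    omega
  · obtain ⟨l, hil, hlk, rfl⟩ := hws z hz
    have := hp.dist_getVert hG (hlk.trans hm)
    omega

/-- A detour from near the `i`-th to near the `m`-th vertex of a side of a thin triangle which
crosses the boundary of a left neighbourhood only along the other two sides. -/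
theorem exists_walk_crossing_other_sides (hG : G.Connected) {δ : ℕ}
    (hthin : ∀ (a b c : V) (p : G.Walk a b) (q : G.Walk a c), IsGeodesic G p → IsGeodesic G q →
      ∀ i : ℕ, i ≤ p.length → i ≤ q.length → 2 * i + G.dist b c ≤ p.length + q.length →
        G.dist (p.getVert i) (q.getVert i) ≤ δ)
    {p : G.Walk a b} {q : G.Walk b c} {r : G.Walk a c}
    (hp : IsGeodesic G p) (hq : IsGeodesic G q) (hr : IsGeodesic G r)
    {i m k : ℕ} (him : i ≤ m) (hm : m ≤ p.length) :
    ∃ (u v : V) (w : G.Walk u v), w.length ≤ (m - i) + 4 * δ + 2 ∧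
      G.dist (p.getVert i) u ≤ δ ∧ (i = 0 → u = p.getVert i) ∧
      G.dist (p.getVert m) v ≤ δ ∧ (m = p.length → v = p.getVert m) ∧
      ∀ s t, s(s, t) ∈ w.edges → s ∈ G.leftNeighborhood a b k δ →
        s(s, t) ∈ q.edges ∨ s(s, t) ∈ r.edges := by
  have hab : p.length = G.dist a b := hp
  have hac : r.length = G.dist a c := hr
  have hbc : q.length = G.dist b c := hq
  have ht₁ := hG.dist_triangle (u := a) (v := c) (w := b)
  have ht₂ := hG.dist_triangle (u := a) (v := b) (w := c)
  have ht₃ := hG.dist_triangle (u := b) (v := a) (w := c)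
  rw [G.dist_comm (u := c) (v := b)] at ht₁
  rw [G.dist_comm (u := b) (v := a)] at ht₃
  have near_r : ∀ l, 2 * l + q.length ≤ p.length + r.length →
      G.dist (p.getVert l) (r.getVert l) ≤ δ := fun l hl ↦
    hthin a b c p r hp hr l (by omega) (by omega) (by omega)
  have near_q : ∀ l ≤ p.length, 2 * (p.length - l) + r.length ≤ p.length + q.length →
      G.dist (p.getVert l) (q.getVert (p.length - l)) ≤ δ := fun l hl hl' ↦ by
    have := hthin b a c p.reverse q hp.reverse hq (p.length - l) (by simp) (by omega)
      (by rw [Walk.length_reverse]; omega)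
    rwa [Walk.getVert_reverse, Nat.sub_sub_self hl] at this
  by_cases h₁ : 2 * m + q.length ≤ p.length + r.length ∧ m < p.length
  · obtain ⟨w, hw, hwe, -⟩ := r.exists_walk_getVert him (by omega)
    refine ⟨_, _, w, by omega, near_r i (by omega), ?_, near_r m h₁.1, by omega,
      fun s t hst _ ↦ .inr (hwe hst)⟩
    rintro rfl; simp
  by_cases h₂ : p.length + r.length < 2 * i + q.length
  · obtain ⟨w, hw, hwe, -⟩ := q.exists_walk_getVert (i := p.length - m) (j := p.length - i)
      (by omega) (by omega)
    refine ⟨_, _, w.reverse, by rw [Walk.length_reverse]; omega, near_q i (by omega) (by omega),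
      by omega, near_q m hm (by omega), ?_, fun s t hst _ ↦ .inl (hwe (by simpa using hst))⟩
    rintro rfl; simp
  obtain ⟨j, hj, hj', hjl⟩ : ∃ j, 2 * j + p.length ≤ r.length + q.length ∧
      (j = 0 ∨ 2 * j + p.length + 3 * δ + 1 ≤ r.length + q.length) ∧
      r.length + q.length ≤ 2 * j + p.length + 3 * δ + 2 :=
    ⟨(r.length + q.length - p.length - 3 * δ - 1) / 2, by omega, by omega, by omega⟩
  obtain ⟨w₁, hw₁, hwe₁, -⟩ := r.exists_walk_getVert (i := i) (j := r.length - j)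
    (by omega) (by omega)
  obtain ⟨w₂, hw₂, hwe₂, -⟩ := q.exists_walk_getVert (i := p.length - m) (j := q.length - j)
    (by omega) (by omega)
  obtain ⟨t, ht⟩ := hG.exists_walk_length_eq_dist (r.getVert (r.length - j))
    (q.getVert (q.length - j))
  have hδ : t.length ≤ δ := by
    have := hthin c a b r.reverse q.reverse hr.reverse hq.reverse j (by simp; omega)
      (by simp; omega) (by simp only [Walk.length_reverse]; omega)
    rwa [Walk.getVert_reverse, Walk.getVert_reverse, ← ht] at this
  refine ⟨_, _, (w₁.append t).append w₂.reverse, ?_, near_r i (by omega), ?_,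
    near_q m hm (by omega), ?_, fun x y hxy hx ↦ ?_⟩
  · simp only [Walk.length_append, Walk.length_reverse]; omega
  · rintro rfl; simp
  · rintro rfl; simp
  simp only [Walk.edges_append, Walk.edges_reverse, List.mem_append, List.mem_reverse] at hxy
  rcases hxy with (hxy | hxy) | hxy
  · exact .inr (hwe₁ hxy)
  · exfalso
    rcases hj' with rfl | hj'
    · have h0 : t.length = 0 := by simp [ht]
      rw [← Walk.length_edges, List.length_eq_zero_iff] at h0
      simp [h0] at hxy
    · have h₃ := t.dist_add_dist_le_length (t.fst_mem_support_of_mem_edges hxy)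
      have h₄ := (hr.dist_getVert hG (l := r.length - j) (by omega)).1
      have h₅ := (hq.dist_getVert hG (l := q.length - j) (by omega)).1
      have h₆ := hG.dist_triangle (u := a) (v := x) (w := r.getVert (r.length - j))
      have h₇ := hG.dist_triangle (u := b) (v := x) (w := q.getVert (q.length - j))
      rw [G.dist_comm (u := x)] at h₆
      rw [G.dist_comm (u := b) (v := x)] at h₇
      simp only [leftNeighborhood, Set.mem_ofPred_eq] at hx
      omega
  · exact .inl (hwe₂ hxy)

end SimpleGraph

/-- Every connected δ-hyperbolic (thin triangles) fine graph is alternatively hyperbolic: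
for every edge `e`, the finite set `F` consisting of `e` together with all edges lying on
circuits of length at most `24δ+6` through `e` is such that every geodesic triangle with `e`
on one side contains an edge of `F` on another side. -/
theorem fine_hyperbolic_implies_alt_hyperbolic {M : Type*} (Γ : SimpleGraph M)
    (hconn : Γ.Connected) (δ : ℕ)
    (hfine : ∀ (x y : M) (n : ℕ), {w : Γ.Walk x y | w.IsPath ∧ w.length ≤ n}.Finite)
    (hthin : ∀ (a b c : M) (p : Γ.Walk a b) (q : Γ.Walk a c), IsGeodesic Γ p → IsGeodesic Γ q →
      ∀ i : ℕ, i ≤ p.length → i ≤ q.length → 2 * i + Γ.dist b c ≤ p.length + q.length →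
        Γ.dist (p.getVert i) (q.getVert i) ≤ δ) :
    ∀ e ∈ Γ.edgeSet,
      ∀ F : Set (Sym2 M),
        F = insert e {f : Sym2 M | ∃ (x : M) (w : Γ.Walk x x), w.IsCycle ∧
          w.length ≤ 24 * δ + 6 ∧ e ∈ w.edges ∧ f ∈ w.edges} →
        F.Finite ∧
        ∀ (a b c : M) (p : Γ.Walk a b) (q : Γ.Walk b c) (r : Γ.Walk c a),
          IsGeodesic Γ p → IsGeodesic Γ q → IsGeodesic Γ r → e ∈ p.edges →
            ∃ f ∈ F, f ∈ q.edges ∨ f ∈ r.edges := by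
  intro e he F hF
  subst hF
  refine ⟨(Γ.finite_edges_of_isCycle_of_length_le hfine e _).insert e, ?_⟩
  intro a b c p q r hp hq hr hep
  by_cases heqr : e ∈ q.edges ∨ e ∈ r.edges
  · exact ⟨e, Set.mem_insert _ _, heqr⟩
  induction e with
  | _ x y =>
  obtain ⟨k, hk, hxy⟩ := p.mk_mem_edges_iff_exists.mp hep
  rw [← hxy] at heqr ⊢
  obtain ⟨u, v, w, hw, hu, hu0, hv, hvn, hwS⟩ :=
    SimpleGraph.exists_walk_crossing_other_sides hconn hthin hp hq hr.reverse
      (i := k - δ) (m := min (k + 1 + δ) p.length) (k := k) (by omega) (by omega)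
  obtain ⟨w₁, hw₁, hwA⟩ := SimpleGraph.exists_walk_subset_leftNeighborhood hconn hp
    (k := k) (by omega) hk.le hu <| by
      rcases le_or_gt δ k with h | h
      · omega
      · simp [hu0 (by omega)]
  obtain ⟨w₂, hw₂, hwB⟩ := SimpleGraph.exists_walk_disjoint_leftNeighborhood hconn hp
    (k := k) (by omega) (by omega) hv <| by
      rcases le_or_gt (k + 1 + δ) p.length with h | h
      · omega
      · rw [hvn (by omega), SimpleGraph.dist_self]; omega
  simp only [SimpleGraph.Walk.edges_reverse, List.mem_reverse] at hwS
  obtain ⟨z, hz, hzl, hez, f, hfS, hf⟩ :=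
    SimpleGraph.Walk.exists_isCycle_of_crossing_edges (p.adj_getVert_succ hk)
      ((w₁.append w).append w₂) (A := Γ.leftNeighborhood a b k δ)
      (S := {f | f ∈ q.edges ∨ f ∈ r.edges})
      (hwA _ w₁.start_mem_support) (hwB _ w₂.end_mem_support) heqr <| by
        intro s t hst hs ht
        simp only [SimpleGraph.Walk.edges_append, List.mem_append] at hst
        rcases hst with (hst | hst) | hst
        · exact absurd (hwA _ (w₁.snd_mem_support_of_mem_edges hst)) ht
        · exact hwS s t hst hs
        · exact absurd hs (hwB _ (w₂.fst_mem_support_of_mem_edges hst))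
  refine ⟨f, Set.mem_insert_of_mem _ ⟨_, z, hz, ?_, hez, hf⟩, hfS⟩
  simp only [SimpleGraph.Walk.length_append] at hzl
  omega
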